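/- arXiv:2406.03234 — 2 statements merged into one kernel-verified Lean document; each statement's English description precedes it below -/
import Mathlib

section
/- Let p be a factorized transition density, let E ⊆ X be measurable with μ(E) > 0, and let G be a bipartite graph from I to J. If there is no f ∈ F_E(G) such that f(x,·) = p(x,·) ν-a.e. for μ-a.e. x ∈ E, then inf_{f ∈ F_E(G)} KL_E(p, f) > 0. -/
open MeasureTheory
open scoped ENNReal

namespace FCDL

variable {N M : ℕ}
variable {X : Fin (N + M) → Type*} {Y : Fin N → Type*}
variable [∀ i, MeasurableSpace (X i)] [∀ j, MeasurableSpace (Y j)]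

/-- Restriction of `x : ∀ i, X i` to the coordinates in the finite index set `T`. -/
def restr (T : Finset (Fin (N + M))) (x : ∀ i, X i) :
    (i : {i // i ∈ T}) → X i.val :=
  fun i => x i.val

/-- `pj` is the family of conditional factors of a factorized transition density:
each `pj j` is jointly measurable, strictly positive, and `pj j x ·` is a probability
density with respect to `ν j` for every `x`. -/
structure IsFTD (ν : ∀ j, Measure (Y j)) (pj : ∀ j, (∀ i, X i) → Y j → ℝ) : Prop where
  measurable : ∀ j, Measurable (Function.uncurry (pj j))
  pos : ∀ j x y, 0 < pj j x y
  density : ∀ j x, ∫ y, pj j x y ∂(ν j) = 1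

/-- The full factorized transition density `p(x,y) = ∏ j, p_j(x, y_j)`. -/
def Pfull (pj : ∀ j, (∀ i, X i) → Y j → ℝ) (x : ∀ i, X i) (y : ∀ j, Y j) : ℝ :=
  ∏ j, pj j x (y j)

/-- `T` is a local parent set for output `j` on the context `E`: on `E`, the conditional
density of `Y j` depends on `x` only through the coordinates `x_T`. -/
def IsLPS (μ : Measure (∀ i, X i)) (ν : ∀ j, Measure (Y j))
    (pj : ∀ j, (∀ i, X i) → Y j → ℝ) (E : Set (∀ i, X i)) (j : Fin N)
    (T : Finset (Fin (N + M))) : Prop :=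
  ∃ g : ((i : {i // i ∈ T}) → X i.val) → Y j → ℝ,
    Measurable (Function.uncurry g) ∧
    ∀ᵐ x ∂μ, x ∈ E → (∀ᵐ y ∂(ν j), pj j x y = g (restr T x) y)

/-- `T` is an inclusion-minimal local parent set for `j` on `E`. -/
def IsMinLPS (μ : Measure (∀ i, X i)) (ν : ∀ j, Measure (Y j))
    (pj : ∀ j, (∀ i, X i) → Y j → ℝ) (E : Set (∀ i, X i)) (j : Fin N)
    (T : Finset (Fin (N + M))) : Prop :=
  IsLPS μ ν pj E j T ∧ ∀ T' : Finset (Fin (N + M)), T' ⊂ T → ¬ IsLPS μ ν pj E j T'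

/-- `E`-faithfulness: every local parent set for `j` on `E` contains the minimal local
parent set `Pa(j;E)` (so the minimal local parent set is unique). -/
def Faithful (μ : Measure (∀ i, X i)) (ν : ∀ j, Measure (Y j))
    (pj : ∀ j, (∀ i, X i) → Y j → ℝ) (E : Set (∀ i, X i)) : Prop :=
  ∀ (j : Fin N) (P T : Finset (Fin (N + M))),
    IsMinLPS μ ν pj E j P → IsLPS μ ν pj E j T → P ⊆ T

/-- A bipartite graph from `I` to `J` is encoded by its parent map `j ↦ Pa^G(j)`;
`edgeCount G` is its number of edges `|G|`. -/
def edgeCount (G : Fin N → Finset (Fin (N + M))) : ℕ := ∑ j, (G j).card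

/-- Membership in the class `F_E(G)` of strictly positive transition densities which,
on `E`, factorize through the parents prescribed by the graph `G`. -/
def MemF (ν : ∀ j, Measure (Y j)) (E : Set (∀ i, X i))
    (G : Fin N → Finset (Fin (N + M)))
    (f : (∀ i, X i) → (∀ j, Y j) → ℝ) : Prop :=
  Measurable (Function.uncurry f) ∧
  (∀ x y, 0 < f x y) ∧
  (∀ x, ∫ y, f x y ∂(Measure.pi ν) = 1) ∧
  ∃ fj : ∀ j : Fin N, ((i : {i // i ∈ G j}) → X i.val) → Y j → ℝ,
    (∀ j, Measurable (Function.uncurry (fj j))) ∧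
    (∀ j, ∀ x ∈ E, ∫ y, fj j (restr (G j) x) y ∂(ν j) = 1) ∧
    (∀ x ∈ E, ∀ y : ∀ j, Y j, f x y = ∏ j, fj j (restr (G j) x) (y j))

/-- The conditional probability measure `μ_E = μ(· ∩ E)/μ(E)`. -/
noncomputable def condMeasure (μ : Measure (∀ i, X i)) (E : Set (∀ i, X i)) :
    Measure (∀ i, X i) := (μ E)⁻¹ • μ.restrict E

open Classical in
/-- `KL_E(p, f) = ∫ μ_E(dx) ∫ p(x,y) log (p(x,y)/f(x,y)) ν(dy) ∈ [0,∞]`, with the usual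
convention that a non-integrable inner relative entropy is `∞`. -/
noncomputable def klE (μ : Measure (∀ i, X i)) (ν : ∀ j, Measure (Y j))
    (p f : (∀ i, X i) → (∀ j, Y j) → ℝ) (E : Set (∀ i, X i)) : ℝ≥0∞ :=
  ∫⁻ x, (if Integrable (fun y => p x y * Real.log (p x y / f x y)) (Measure.pi ν)
      then ENNReal.ofReal (∫ y, p x y * Real.log (p x y / f x y) ∂(Measure.pi ν))
      else ⊤) ∂(condMeasure μ E)

/-- A `K`-decomposition: a measurable partition of the state-action space into `K`
cells of positive measure. -/
structure IsDecomp (μ : Measure (∀ i, X i)) {K : ℕ} (E : Fin K → Set (∀ i, X i)) : Prop where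
  measurableSet : ∀ z, MeasurableSet (E z)
  pos : ∀ z, 0 < μ (E z)
  disjoint : Pairwise (Function.onFun Disjoint E)
  cover : (⋃ z, E z) = Set.univ

/-- The regularized maximum-likelihood score `S({G_z, E_z})`, valued in the extended reals. -/
noncomputable def score (μ : Measure (∀ i, X i)) (ν : ∀ j, Measure (Y j))
    (pj : ∀ j, (∀ i, X i) → Y j → ℝ) (lam : ℝ) {K : ℕ}
    (E : Fin K → Set (∀ i, X i)) (G : Fin K → (Fin N → Finset (Fin (N + M)))) : EReal :=
  sSup { r : EReal | ∃ f : Fin K → ((∀ i, X i) → (∀ j, Y j) → ℝ),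
      (∀ z, MemF ν (E z) (G z) (f z)) ∧
      r = ((∑ z, ∫ x in E z, ∫ y, Pfull pj x y * Real.log (f z x y)
              ∂(Measure.pi ν) ∂μ : ℝ) : EReal) }
    - ((lam * ∑ z, (μ (E z)).toReal * (edgeCount (G z) : ℝ) : ℝ) : EReal)

/-- The entropy condition: `p log p` is integrable with respect to `μ ⊗ ν`. -/
def EntropyCond (μ : Measure (∀ i, X i)) (ν : ∀ j, Measure (Y j))
    (pj : ∀ j, (∀ i, X i) → Y j → ℝ) : Prop :=
  Integrable (fun q : (∀ i, X i) × (∀ j, Y j) =>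
    Pfull pj q.1 q.2 * Real.log (Pfull pj q.1 q.2)) (μ.prod (Measure.pi ν))

open Classical in
/-- The local causal graph `G_E` (the family of minimal local parent sets), chosen via
choice; under faithfulness it is the unique minimal local parent set family. -/
noncomputable def theLCG (μ : Measure (∀ i, X i)) (ν : ∀ j, Measure (Y j))
    (pj : ∀ j, (∀ i, X i) → Y j → ℝ) (E : Set (∀ i, X i)) :
    Fin N → Finset (Fin (N + M)) :=
  fun j => if h : ∃ T, IsMinLPS μ ν pj E j T then h.choose else ∅

/-- `η({E_z})`: the minimum over cells `z` of the (normalized) smallest KL gap over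
graphs `G'` that miss an edge of `G_{E_z}` and have fewer edges. -/
noncomputable def etaDecomp (μ : Measure (∀ i, X i)) (ν : ∀ j, Measure (Y j))
    (pj : ∀ j, (∀ i, X i) → Y j → ℝ) {K : ℕ} (E : Fin K → Set (∀ i, X i)) : ℝ≥0∞ :=
  ⨅ z : Fin K, ⨅ G' ∈ {G' : Fin N → Finset (Fin (N + M)) |
      (¬ ∀ j, theLCG μ ν pj (E z) j ⊆ G' j) ∧
        edgeCount G' < edgeCount (theLCG μ ν pj (E z))},
    ENNReal.ofReal (1 / ((N : ℝ) * (N + M) + 1)) *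
      ⨅ f ∈ {f | MemF ν (E z) G' f}, klE μ ν (Pfull pj) f (E z)

/-- `η* = inf` of `η({E_z})` over all `K`-decompositions. -/
noncomputable def etaStar (μ : Measure (∀ i, X i)) (ν : ∀ j, Measure (Y j))
    (pj : ∀ j, (∀ i, X i) → Y j → ℝ) (K : ℕ) : ℝ≥0∞ :=
  ⨅ E ∈ {E : Fin K → Set (∀ i, X i) | IsDecomp μ E}, etaDecomp μ ν pj E

/-- `D` is canonical: every positive-measure measurable subset of `D` has the same
local causal graph as `D`. -/
def Canonical (μ : Measure (∀ i, X i)) (ν : ∀ j, Measure (Y j))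
    (pj : ∀ j, (∀ i, X i) → Y j → ℝ) (D : Set (∀ i, X i)) : Prop :=
  ∀ C : Set (∀ i, X i), MeasurableSet C → C ⊆ D → 0 < μ C →
    ∀ (j : Fin N) (T : Finset (Fin (N + M))),
      IsMinLPS μ ν pj C j T ↔ IsMinLPS μ ν pj D j T


lemma aux_log (p f : ℝ) (hp : 0 < p) (hf : 0 < f) :
    2 * p - 2 * (√p * √f) ≤ p * Real.log (p / f) := by
  have hsp : 0 < √p := Real.sqrt_pos.2 hp
  have hsf : 0 < √f := Real.sqrt_pos.2 hf
  have h1 : Real.log (√f / √p) ≤ √f / √p - 1 := Real.log_le_sub_one_of_pos (by positivity)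
  have h2 : Real.log (p / f) = - (2 * Real.log (√f / √p)) := by
    rw [Real.log_div hp.ne' hf.ne', Real.log_div hsf.ne' hsp.ne', Real.log_sqrt hf.le,
      Real.log_sqrt hp.le]
    ring
  have h3 : p * (√f / √p) = √p * √f := by
    have : p = √p * √p := (Real.mul_self_sqrt hp.le).symm
    field_simp
    rw [Real.sq_sqrt hp.le]
  rw [h2]
  have := mul_le_mul_of_nonneg_left h1 hp.le
  rw [mul_sub, h3] at this
  linarith

lemma aux_integrable {Z : Type*} [MeasurableSpace Z] {ν : Measure Z} {a : Z → ℝ}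
    (h : ∫ y, a y ∂ν = 1) : Integrable a ν := by
  by_contra hc
  rw [integral_undef hc] at h
  exact zero_ne_one h

lemma aux_sqrt {Z : Type*} [MeasurableSpace Z] {ν : Measure Z} {a b : Z → ℝ}
    (ha : Measurable a) (hb : Measurable b) (ha0 : ∀ y, 0 < a y) (hb0 : ∀ y, 0 < b y)
    (hai : ∫ y, a y ∂ν = 1) (hbi : ∫ y, b y ∂ν = 1) :
    Integrable (fun y => √(a y) * √(b y)) ν ∧ 0 ≤ ∫ y, √(a y) * √(b y) ∂ν ∧
    ∫ y, √(a y) * √(b y) ∂ν ≤ 1 ∧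
    ∫⁻ y, ENNReal.ofReal ((√(a y) - √(b y)) ^ 2) ∂ν
      = ENNReal.ofReal (2 - 2 * ∫ y, √(a y) * √(b y) ∂ν) := by
  have ia := aux_integrable hai
  have ib := aux_integrable hbi
  have hle : ∀ y, √(a y) * √(b y) ≤ (a y + b y) / 2 := by
    intro y
    nlinarith [sq_nonneg (√(a y) - √(b y)), Real.sq_sqrt (ha0 y).le, Real.sq_sqrt (hb0 y).le]
  have iab : Integrable (fun y => √(a y) * √(b y)) ν := by
    refine Integrable.mono' ((ia.add ib).div_const 2)
      (ha.sqrt.mul hb.sqrt).aestronglyMeasurable (Filter.Eventually.of_forall fun y => ?_)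
    rw [Real.norm_of_nonneg (by positivity)]
    exact hle y
  have heq : ∀ y, (√(a y) - √(b y)) ^ 2 = a y + b y - 2 * (√(a y) * √(b y)) := by
    intro y
    nlinarith [Real.sq_sqrt (ha0 y).le, Real.sq_sqrt (hb0 y).le]
  have iS : Integrable (fun y => a y + b y - 2 * (√(a y) * √(b y))) ν :=
    (ia.add ib).sub (iab.const_mul 2)
  have hval : ∫ y, (√(a y) - √(b y)) ^ 2 ∂ν = 2 - 2 * ∫ y, √(a y) * √(b y) ∂ν := by
    simp_rw [heq]
    have iadd : Integrable (fun y => a y + b y) ν := ia.add ib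
    rw [integral_sub iadd (iab.const_mul 2), integral_const_mul, integral_add ia ib, hai, hbi]
    norm_num
  refine ⟨iab, integral_nonneg fun y => by positivity, ?_, ?_⟩
  · have : 0 ≤ ∫ y, (√(a y) - √(b y)) ^ 2 ∂ν := integral_nonneg fun y => sq_nonneg _
    linarith
  · rw [← hval, ofReal_integral_eq_lintegral_ofReal]
    · exact iS.congr (Filter.Eventually.of_forall fun y => (heq y).symm)
    · exact Filter.Eventually.of_forall fun y => sq_nonneg _

/-- positivity of factors of a positive product of functions with integral one -/
lemma aux_pos {N : ℕ} {Y : Fin N → Type*} [∀ j, MeasurableSpace (Y j)]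
    [∀ j, Nonempty (Y j)] (ν : ∀ j, Measure (Y j)) (b : ∀ j, Y j → ℝ)
    (hb : ∀ y : ∀ j, Y j, 0 < ∏ j, b j (y j)) (hbi : ∀ j, ∫ y, b j y ∂(ν j) = 1) :
    ∀ j y, 0 < b j y := by
  intro j y
  let y0 : ∀ j, Y j := fun j => Classical.arbitrary _
  have key : ∀ z : Y j, 0 < b j z * ∏ k ∈ Finset.univ.erase j, b k (y0 k) := by
    intro z
    have h := hb (Function.update y0 j z)
    rw [← Finset.mul_prod_erase _ _ (Finset.mem_univ j)] at h
    rw [Function.update_self] at h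
    rw [Finset.prod_congr rfl (g := fun k => b k (y0 k))] at h
    · exact h
    · intro k hk
      rw [Function.update_of_ne (Finset.ne_of_mem_erase hk)]
  set c := ∏ k ∈ Finset.univ.erase j, b k (y0 k)
  have hc : 0 < c := by
    by_contra hc
    have : ∫ y, b j y ∂(ν j) ≤ 0 := by
      refine integral_nonpos fun z => ?_
      by_contra hz
      have hz : 0 < b j z := not_le.1 hz
      have := mul_nonpos_of_nonneg_of_nonpos hz.le (not_lt.1 hc)
      linarith [key z]
    linarith [hbi j]
  exact pos_of_mul_pos_left (key y) hc.le

/-- Pointwise-in-`x` bound. -/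
lemma aux_kl {N : ℕ} {Y : Fin N → Type*} [∀ j, MeasurableSpace (Y j)]
    (ν : ∀ j, Measure (Y j)) [∀ j, SigmaFinite (ν j)] (a b : ∀ j, Y j → ℝ)
    (ha : ∀ j, Measurable (a j)) (hb : ∀ j, Measurable (b j))
    (ha0 : ∀ j y, 0 < a j y) (hb0 : ∀ j y, 0 < b j y)
    (hai : ∀ j, ∫ y, a j y ∂(ν j) = 1) (hbi : ∀ j, ∫ y, b j y ∂(ν j) = 1)
    (hint : Integrable (fun y : ∀ j, Y j =>
      (∏ j, a j (y j)) * Real.log ((∏ j, a j (y j)) / ∏ j, b j (y j))) (Measure.pi ν))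
    (j : Fin N) :
    ∫⁻ y, ENNReal.ofReal ((√(a j y) - √(b j y)) ^ 2) ∂(ν j) ≤
      ENNReal.ofReal (∫ y : ∀ j, Y j,
      (∏ j, a j (y j)) * Real.log ((∏ j, a j (y j)) / ∏ j, b j (y j)) ∂(Measure.pi ν)) := by
  have H := fun j => aux_sqrt (ha j) (hb j) (ha0 j) (hb0 j) (hai j) (hbi j)
  rw [(H j).2.2.2]
  apply ENNReal.ofReal_le_ofReal
  have I1 : Integrable (fun y : ∀ j, Y j => ∏ j, a j (y j)) (Measure.pi ν) :=
    Integrable.fintype_prod_dep fun j => aux_integrable (hai j)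
  have I2 : Integrable (fun y : ∀ j, Y j => ∏ j, (√(a j (y j)) * √(b j (y j)))) (Measure.pi ν) :=
    Integrable.fintype_prod_dep (f := fun j y => √(a j y) * √(b j y)) fun j => (H j).1
  have V1 : ∫ y : ∀ j, Y j, ∏ j, a j (y j) ∂(Measure.pi ν) = 1 := by
    rw [integral_fintype_prod_eq_prod]
    simp [hai]
  have V2 : ∫ y : ∀ j, Y j, ∏ j, (√(a j (y j)) * √(b j (y j))) ∂(Measure.pi ν)
      = ∏ j, ∫ y, √(a j y) * √(b j y) ∂(ν j) :=
    integral_fintype_prod_eq_prod (f := fun j y => √(a j y) * √(b j y))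
  have hprod : ∏ j, ∫ y, √(a j y) * √(b j y) ∂(ν j) ≤ ∫ y, √(a j y) * √(b j y) ∂(ν j) := by
    rw [← Finset.mul_prod_erase _ _ (Finset.mem_univ j)]
    exact mul_le_of_le_one_right (H j).2.1
      (Finset.prod_le_one (fun k _ => (H k).2.1) fun k _ => (H k).2.2.1)
  have hmono : ∫ y : ∀ j, Y j, (2 * ∏ j, a j (y j)) - 2 * ∏ j, (√(a j (y j)) * √(b j (y j)))
      ∂(Measure.pi ν) ≤ ∫ y : ∀ j, Y j,
      (∏ j, a j (y j)) * Real.log ((∏ j, a j (y j)) / ∏ j, b j (y j)) ∂(Measure.pi ν) := by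
    refine integral_mono ((I1.const_mul 2).sub (I2.const_mul 2)) hint fun y => ?_
    have := aux_log (∏ j, a j (y j)) (∏ j, b j (y j))
      (Finset.prod_pos fun j _ => ha0 j _) (Finset.prod_pos fun j _ => hb0 j _)
    simp only
    rw [Finset.prod_mul_distrib, ← Real.sqrt_prod _ fun j _ => (ha0 j _).le,
      ← Real.sqrt_prod _ fun j _ => (hb0 j _).le]
    exact this
  rw [integral_sub (I1.const_mul 2) (I2.const_mul 2), integral_const_mul, integral_const_mul,
    V1, V2] at hmono
  linarith

lemma aux_tendsto (u : ℕ → ℝ) (a : ℝ) (ha : 0 ≤ a) (hu : ∀ n, 0 ≤ u n)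
    (h : ∑' n, ENNReal.ofReal ((√a - √(u n)) ^ 2) ≠ ∞) :
    Filter.Tendsto u Filter.atTop (nhds a) := by
  have h1 := ENNReal.tendsto_atTop_zero_of_tsum_ne_top h
  have h2 : Filter.Tendsto (fun n => (√a - √(u n)) ^ 2) Filter.atTop (nhds 0) := by
    have := (ENNReal.tendsto_toReal ENNReal.zero_ne_top).comp h1
    refine this.congr fun n => ?_
    simp [ENNReal.toReal_ofReal (sq_nonneg _)]
  have h3 : Filter.Tendsto (fun n => √a - √(u n)) Filter.atTop (nhds 0) := by
    have := h2.sqrt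
    simp only [Real.sqrt_sq_eq_abs, Real.sqrt_zero] at this
    exact (tendsto_zero_iff_abs_tendsto_zero _).2 this
  have h4 : Filter.Tendsto (fun n => (√a - (√a - √(u n))) ^ 2) Filter.atTop
      (nhds ((√a - 0) ^ 2)) := (tendsto_const_nhds.sub h3).pow 2
  simpa [Real.sq_sqrt ha, Real.sq_sqrt (hu _)] using h4

/-- Pointwise-in-`f` bound for the KL divergence. -/
lemma klE_ge [∀ j, Nonempty (Y j)]
    (μ : Measure (∀ i, X i)) [IsProbabilityMeasure μ]
    (ν : ∀ j, Measure (Y j)) [∀ j, SigmaFinite (ν j)]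
    (pj : ∀ j, (∀ i, X i) → Y j → ℝ) (hp : IsFTD ν pj)
    (E : Set (∀ i, X i)) (hE : MeasurableSet E)
    (f : (∀ i, X i) → (∀ j, Y j) → ℝ)
    (fj : ∀ j, (∀ i, X i) → Y j → ℝ)
    (hm : ∀ j x, Measurable (fj j x))
    (hpos : ∀ j, ∀ x ∈ E, ∀ y, 0 < fj j x y)
    (hi : ∀ j, ∀ x ∈ E, ∫ y, fj j x y ∂(ν j) = 1)
    (hf : ∀ x ∈ E, ∀ y : ∀ j, Y j, f x y = ∏ j, fj j x (y j)) (j : Fin N) :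
    ∫⁻ x in E, ∫⁻ y, ENNReal.ofReal ((√(pj j x y) - √(fj j x y)) ^ 2) ∂(ν j) ∂μ
      ≤ klE μ ν (Pfull pj) f E := by
  unfold klE condMeasure
  rw [lintegral_smul_measure]
  refine le_trans ?_ (le_mul_of_one_le_left zero_le (ENNReal.one_le_inv.2 prob_le_one))
  refine setLIntegral_mono' hE fun x hx => ?_
  have e : (fun y => Pfull pj x y * Real.log (Pfull pj x y / f x y)) =
      fun y => (∏ j, pj j x (y j)) * Real.log ((∏ j, pj j x (y j)) / ∏ j, fj j x (y j)) := by
    funext y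
    rw [hf x hx, Pfull]
  split_ifs with hint
  · simp only [e] at hint ⊢
    exact aux_kl ν (fun j => pj j x) (fun j => fj j x)
      (fun j => (hp.measurable j).of_uncurry_left)
      (fun j => hm j x) (fun j y => hp.pos j x y) (fun j y => hpos j x hx y)
      (fun j => hp.density j x) (fun j => hi j x hx) hint j
  · exact le_top

lemma measurable_restr (T : Finset (Fin (N + M))) :
    Measurable (restr (X := X) T) :=
  measurable_pi_lambda _ fun i => measurable_pi_apply _

/-- if no member of `F_E(G)` agrees with `p` (a.e. on `E`), then the
infimum of `KL_E(p, ·)` over `F_E(G)` is strictly positive. -/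
theorem kl_inf_pos_of_not_representable
    (hN : 0 < N) (hM : 0 < M)
    [∀ i, StandardBorelSpace (X i)] [∀ j, StandardBorelSpace (Y j)]
    (μ : Measure (∀ i, X i)) [IsProbabilityMeasure μ]
    (ν : ∀ j, Measure (Y j)) [∀ j, SigmaFinite (ν j)]
    (pj : ∀ j, (∀ i, X i) → Y j → ℝ) (hp : IsFTD ν pj)
    (E : Set (∀ i, X i)) (hE : MeasurableSet E) (hEpos : 0 < μ E)
    (G : Fin N → Finset (Fin (N + M)))
    (h : ¬ ∃ f, MemF ν E G f ∧
        ∀ᵐ x ∂μ, x ∈ E → (∀ᵐ y ∂(Measure.pi ν), f x y = Pfull pj x y)) :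
    0 < ⨅ f ∈ {f | MemF ν E G f}, klE μ ν (Pfull pj) f E := by
  classical
  by_contra hcon
  have hinf : ⨅ f ∈ {f | MemF ν E G f}, klE μ ν (Pfull pj) f E = 0 := by
    simpa using hcon
  apply h
  obtain ⟨x0, hx0⟩ : E.Nonempty := nonempty_of_measure_ne_zero hEpos.ne'
  haveI hne : ∀ j, Nonempty (Y j) := by
    intro j
    by_contra hj
    rw [not_nonempty_iff] at hj
    have := hp.density j x0
    rw [Measure.eq_zero_of_isEmpty (ν j), integral_zero_measure] at this
    exact zero_ne_one this
  -- a minimizing sequence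
  have hseq : ∀ n : ℕ, ∃ f, MemF ν E G f ∧ klE μ ν (Pfull pj) f E < (2⁻¹ : ℝ≥0∞) ^ n := by
    intro n
    have : ⨅ f ∈ {f | MemF ν E G f}, klE μ ν (Pfull pj) f E < (2⁻¹ : ℝ≥0∞) ^ n := by
      rw [hinf]
      exact ENNReal.pow_pos (by simp) n
    simpa [iInf_lt_iff] using this
  choose f hfF hfkl using hseq
  choose hfm hfpos hfint fj hfjm hfji hff using hfF
  have hfjpos : ∀ n j, ∀ x ∈ E, ∀ y, 0 < fj n j (restr (G j) x) y := by
    intro n j x hx y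
    exact aux_pos ν (fun j => fj n j (restr (G j) x))
      (fun y => by rw [← hff n x hx y]; exact hfpos n x y) (fun j => hfji n j x hx) j y
  -- the limiting factors
  have hlim : ∀ j, ∃ g : ((i : {i // i ∈ G j}) → X i.val) → Y j → ℝ,
      Measurable (Function.uncurry g) ∧
      ∀ᵐ x ∂(μ.restrict E), ∀ᵐ y ∂(ν j), g (restr (G j) x) y = pj j x y := by
    intro j
    refine ⟨fun t y => Filter.limsup (fun n => fj n j t y) Filter.atTop, ?_, ?_⟩
    · exact Measurable.limsup (fun n => hfjm n j)
    have hmeas : ∀ n, Measurable (fun q : (∀ i, X i) × Y j =>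
        ENNReal.ofReal ((√(pj j q.1 q.2) - √(fj n j (restr (G j) q.1) q.2)) ^ 2)) := by
      intro n
      have h1 : Measurable fun q : (∀ i, X i) × Y j => pj j q.1 q.2 := hp.measurable j
      have h2 : Measurable fun q : (∀ i, X i) × Y j => fj n j (restr (G j) q.1) q.2 :=
        (hfjm n j).comp (((measurable_restr (G j)).comp measurable_fst).prodMk measurable_snd)
      exact ((h1.sqrt.sub h2.sqrt).pow_const 2).ennreal_ofReal
    have hsum : ∫⁻ q, ∑' n, ENNReal.ofReal
        ((√(pj j q.1 q.2) - √(fj n j (restr (G j) q.1) q.2)) ^ 2)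
        ∂((μ.restrict E).prod (ν j)) ≠ ∞ := by
      rw [lintegral_tsum fun n => (hmeas n).aemeasurable]
      refine ne_top_of_le_ne_top (b := ∑' n : ℕ, (2⁻¹ : ℝ≥0∞) ^ n) ?_ ?_
      · rw [ENNReal.tsum_geometric]
        simp
      · refine ENNReal.tsum_le_tsum fun n => ?_
        rw [lintegral_prod _ (hmeas n).aemeasurable]
        refine le_trans ?_ (hfkl n).le
        exact klE_ge μ ν pj hp E hE (f n) (fun j x y => fj n j (restr (G j) x) y)
          (fun j x => (hfjm n j).of_uncurry_left) (hfjpos n) (hfji n) (hff n) j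
    have hae := ae_lt_top' (AEMeasurable.tsum fun n => (hmeas n).aemeasurable) hsum
    have hae2 := Measure.ae_ae_of_ae_prod hae
    filter_upwards [hae2, ae_restrict_mem hE] with x hx hxE
    filter_upwards [hx] with y hy
    exact (aux_tendsto (fun n => fj n j (restr (G j) x) y) (pj j x y) (hp.pos j x y).le
      (fun n => (hfjpos n j x hxE y).le) hy.ne).limsup_eq
  choose g hgm hg using hlim
  -- make the factors positive and normalised
  have hfix : ∀ j, ∃ g : ((i : {i // i ∈ G j}) → X i.val) → Y j → ℝ,
      Measurable (Function.uncurry g) ∧ (∀ t y, 0 < g t y) ∧ (∀ t, ∫ y, g t y ∂(ν j) = 1) ∧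
      ∀ᵐ x ∂(μ.restrict E), ∀ᵐ y ∂(ν j), g (restr (G j) x) y = pj j x y := by
    intro j
    let g1 : ((i : {i // i ∈ G j}) → X i.val) → Y j → ℝ :=
      fun t y => if 0 < g j t y then g j t y else 1
    have hg1m : Measurable (Function.uncurry g1) :=
      Measurable.ite (measurableSet_lt measurable_const (hgm j)) (hgm j) measurable_const
    have hg1pos : ∀ t y, 0 < g1 t y := by
      intro t y
      simp only [g1]
      split_ifs with h
      · exact h
      · exact one_pos
    let B : Set ((i : {i // i ∈ G j}) → X i.val) := {t | ∫ y, g1 t y ∂(ν j) = 1}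
    have hB : MeasurableSet B := by
      have : Measurable fun t => ∫ y, g1 t y ∂(ν j) :=
        (StronglyMeasurable.integral_prod_right' (f := Function.uncurry g1)
          hg1m.stronglyMeasurable).measurable
      exact this (measurableSet_singleton 1)
    refine ⟨fun t y => if t ∈ B then g1 t y else pj j x0 y, ?_, ?_, ?_, ?_⟩
    · exact Measurable.ite (measurable_fst hB) hg1m
        ((hp.measurable j).of_uncurry_left.comp measurable_snd)
    · intro t y
      simp only
      split_ifs
      · exact hg1pos t y
      · exact hp.pos j x0 y
    · intro t
      by_cases ht : t ∈ B
      · simp only [ht, if_true]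
        exact ht
      · simp only [ht, if_false]
        exact hp.density j x0
    · filter_upwards [hg j] with x hx
      have hx1 : ∀ᵐ y ∂(ν j), g1 (restr (G j) x) y = pj j x y := by
        filter_upwards [hx] with y hy
        simp only [g1, hy, hp.pos j x y, if_true]
      have hxB : restr (G j) x ∈ B := by
        change ∫ y, g1 (restr (G j) x) y ∂(ν j) = 1
        rw [integral_congr_ae hx1, hp.density]
      simpa only [hxB, if_true] using hx1
  choose k hkm hkpos hki hk using hfix
  refine ⟨fun x y => ∏ j, k j (restr (G j) x) (y j), ⟨?_, ?_, ?_, k, hkm, ?_, ?_⟩, ?_⟩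
  · refine Finset.measurable_prod _ fun j _ => ?_
    exact (hkm j).comp (((measurable_restr (G j)).comp measurable_fst).prodMk
      ((measurable_pi_apply j).comp measurable_snd))
  · exact fun x y => Finset.prod_pos fun j _ => hkpos j _ _
  · intro x
    rw [integral_fintype_prod_eq_prod (f := fun j => k j (restr (G j) x))]
    simp [hki]
  · exact fun j x _ => hki j _
  · exact fun x _ y => rfl
  · rw [← ae_restrict_iff' hE]
    filter_upwards [ae_all_iff.2 hk] with x hx
    have : ∀ j, ∀ᵐ y ∂(Measure.pi ν), k j (restr (G j) x) (y j) = pj j x (y j) := fun j =>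
      (Measure.tendsto_eval_ae_ae (μ := ν) (i := j)).eventually (hx j)
    filter_upwards [ae_all_iff.2 this] with y hy
    exact Finset.prod_congr rfl fun j _ => hy j

end FCDL
end

section
/- Let p be a factorized transition density, let E ⊆ X be measurable with μ(E) > 0, and let G be a bipartite graph from I to J. Then there exists f̂ ∈ F_E(G) of the form f̂(x,y) = ∏_{j∈J} f̂_j(x_{Pa^G(j)}, y_j), where each f̂_j(x_{Pa^G(j)}, ·) is a version of the conditional density of the coordinate Y_j given the coordinates x_{Pa^G(j)} under the joint law μ_E(dx) p(x,y) ν(dy), such that KL_E(p, f) ≥ KL_E(p, f̂) for every f ∈ F_E(G); consequently inf_{f ∈ F_E(G)} KL_E(p, f) = KL_E(p, f̂). (The product of conditional marginal densities is the KL-projection of p onto the factorized class F_E(G).) -/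
open MeasureTheory
open scoped ENNReal

namespace FCDL

variable {N M : ℕ}
variable {X : Fin (N + M) → Type*} {Y : Fin N → Type*}
variable [∀ i, MeasurableSpace (X i)] [∀ j, MeasurableSpace (Y j)]

/-- The pointwise relative entropy integrand. -/
noncomputable def kg (a b : ℝ) : ℝ := a * Real.log (a / b) + b - a

lemma kg_nonneg {a b : ℝ} (ha : 0 < a) (hb : 0 < b) : 0 ≤ kg a b := by
  have h := Real.one_sub_inv_le_log_of_pos (div_pos ha hb)
  have h2 := mul_le_mul_of_nonneg_left h ha.le
  have h3 : a * (1 - (a / b)⁻¹) = a - b := by field_simp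
  unfold kg
  linarith

lemma kg_measurable : Measurable (Function.uncurry kg) := by
  unfold kg Function.uncurry
  fun_prop

lemma integrable_of_one {S : Type*} [MeasurableSpace S] {ν : Measure S} {a : S → ℝ}
    (h : ∫ y, a y ∂ν = 1) : Integrable a ν := by
  by_contra hn
  rw [integral_undef hn] at h
  exact zero_ne_one h

lemma integral_log_eq {S : Type*} [MeasurableSpace S] {ν : Measure S} {a b : S → ℝ}
    (ha1 : ∫ y, a y ∂ν = 1) (hb1 : ∫ y, b y ∂ν = 1)
    (hi : Integrable (fun y => a y * Real.log (a y / b y)) ν) :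
    Integrable (fun y => kg (a y) (b y)) ν ∧
    ∫ y, a y * Real.log (a y / b y) ∂ν = ∫ y, kg (a y) (b y) ∂ν := by
  have hai := integrable_of_one ha1
  have hbi := integrable_of_one hb1
  refine ⟨(hi.add hbi).sub hai, ?_⟩
  unfold kg
  have e1 := integral_sub (hi.add hbi) hai
  have e2 := integral_add hi hbi
  simp only [Pi.add_apply] at e1
  rw [e1, e2, ha1, hb1]
  ring

open Classical in
lemma inner_eq {S : Type*} [MeasurableSpace S] {ν : Measure S} {a b : S → ℝ}
    (ha : ∀ y, 0 < a y) (hb : ∀ y, 0 < b y)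
    (ham : Measurable a) (hbm : Measurable b)
    (ha1 : ∫ y, a y ∂ν = 1) (hb1 : ∫ y, b y ∂ν = 1) :
    (if Integrable (fun y => a y * Real.log (a y / b y)) ν
      then ENNReal.ofReal (∫ y, a y * Real.log (a y / b y) ∂ν) else ⊤) =
    ∫⁻ y, ENNReal.ofReal (kg (a y) (b y)) ∂ν := by
  have hai := integrable_of_one ha1
  have hbi := integrable_of_one hb1
  split_ifs with hi
  · obtain ⟨h1, h2⟩ := integral_log_eq ha1 hb1 hi
    rw [h2, ofReal_integral_eq_lintegral_ofReal h1
      (Filter.Eventually.of_forall fun y => kg_nonneg (ha y) (hb y))]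
  · by_contra hne
    apply hi
    have hk : Integrable (fun y => kg (a y) (b y)) ν := by
      refine ⟨(kg_measurable.comp (ham.prodMk hbm)).aestronglyMeasurable, ?_⟩
      rw [hasFiniteIntegral_iff_ofReal
        (Filter.Eventually.of_forall fun y => kg_nonneg (ha y) (hb y))]
      exact lt_top_iff_ne_top.2 (Ne.symm hne)
    refine ((hk.sub hbi).add hai).congr (Filter.Eventually.of_forall fun y => ?_)
    simp only [Pi.add_apply, Pi.sub_apply, kg]
    ring

lemma integral_log_nonneg {S : Type*} [MeasurableSpace S] {ν : Measure S} {a b : S → ℝ}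
    (ha : ∀ y, 0 < a y) (hb : ∀ y, 0 < b y)
    (ha1 : ∫ y, a y ∂ν = 1) (hb1 : ∫ y, b y ∂ν = 1) :
    0 ≤ ∫ y, a y * Real.log (a y / b y) ∂ν := by
  by_cases hi : Integrable (fun y => a y * Real.log (a y / b y)) ν
  · rw [(integral_log_eq ha1 hb1 hi).2]
    exact integral_nonneg fun y => kg_nonneg (ha y) (hb y)
  · rw [integral_undef hi]

/-- Pointwise compensation inequality. -/
lemma compensation {Ω : Type*} [MeasurableSpace Ω] (κ : Measure Ω) [IsProbabilityMeasure κ]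
    {p : Ω → ℝ} (hp : ∀ x, 0 < p x) (hpm : Measurable p) (hpi : Integrable p κ)
    (hh : 0 < ∫ x, p x ∂κ) {f : ℝ} (hf : 0 < f) :
    ∫⁻ x, ENNReal.ofReal (kg (p x) (∫ x, p x ∂κ)) ∂κ ≤
      ∫⁻ x, ENNReal.ofReal (kg (p x) f) ∂κ := by
  set h := ∫ x, p x ∂κ with hdef
  by_cases htop : ∫⁻ x, ENNReal.ofReal (kg (p x) f) ∂κ = ⊤
  · rw [htop]; exact le_top
  have hk : Integrable (fun x => kg (p x) f) κ := by
    refine ⟨(kg_measurable.comp (hpm.prodMk measurable_const)).aestronglyMeasurable, ?_⟩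
    rw [hasFiniteIntegral_iff_ofReal
      (Filter.Eventually.of_forall fun y => kg_nonneg (hp y) hf)]
    exact lt_top_iff_ne_top.2 htop
  have heq : ∀ x, kg (p x) h = kg (p x) f - (p x * Real.log (h / f) + (f - h)) := by
    intro x
    unfold kg
    rw [Real.log_div (hp x).ne' hh.ne', Real.log_div (hp x).ne' hf.ne',
      Real.log_div hh.ne' hf.ne']
    ring
  have hm : Integrable (fun x => p x * Real.log (h / f)) κ := hpi.mul_const _
  have hc : Integrable (fun _ : Ω => f - h) κ := integrable_const _
  have hk2 : Integrable (fun x => kg (p x) h) κ := by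
    simp_rw [heq]
    exact hk.sub (hm.add hc)
  rw [← ofReal_integral_eq_lintegral_ofReal hk
      (Filter.Eventually.of_forall fun y => kg_nonneg (hp y) hf),
    ← ofReal_integral_eq_lintegral_ofReal hk2
      (Filter.Eventually.of_forall fun y => kg_nonneg (hp y) hh)]
  apply ENNReal.ofReal_le_ofReal
  simp_rw [heq]
  have e1 := integral_sub hk (hm.add hc)
  have e2 := integral_add hm hc
  simp only [Pi.add_apply] at e1
  rw [e1, e2, integral_mul_const, integral_const, ← hdef]
  have := kg_nonneg hh hf
  unfold kg at this
  simp
  linarith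

/-- Existence of the conditional density, and its minimality. -/
lemma exists_proj {Ω T S : Type*} [MeasurableSpace Ω] [StandardBorelSpace Ω]
    [MeasurableSpace T] [MeasurableSpace S] (μ : Measure Ω) [IsProbabilityMeasure μ]
    (ν : Measure S) [SigmaFinite ν] (r : Ω → T) (hr : Measurable r)
    (p : Ω → S → ℝ) (hpm : Measurable (Function.uncurry p)) (hp : ∀ x y, 0 < p x y)
    (hp1 : ∀ x, ∫ y, p x y ∂ν = 1) :
    ∃ g : T → S → ℝ, Measurable (Function.uncurry g) ∧ (∀ t y, 0 < g t y) ∧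
      (∀ t, ∫ y, g t y ∂ν = 1) ∧
      (∀ A B, MeasurableSet A → MeasurableSet B →
        ∫⁻ x in {x | r x ∈ A}, (∫⁻ y in B, ENNReal.ofReal (p x y) ∂ν) ∂μ =
        ∫⁻ x in {x | r x ∈ A}, (∫⁻ y in B, ENNReal.ofReal (g (r x) y) ∂ν) ∂μ) ∧
      (∀ f : T → S → ℝ, Measurable (Function.uncurry f) → (∀ t y, 0 < f t y) →
        ∫⁻ x, ∫⁻ y, ENNReal.ofReal (kg (p x y) (g (r x) y)) ∂ν ∂μ ≤
        ∫⁻ x, ∫⁻ y, ENNReal.ofReal (kg (p x y) (f (r x) y)) ∂ν ∂μ) := by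
  have hΩ : Nonempty Ω := by
    by_contra h
    rw [not_nonempty_iff] at h
    have := IsProbabilityMeasure.measure_univ (μ := μ)
    rw [Set.univ_eq_empty_iff.2 h, measure_empty] at this
    exact zero_ne_one this
  let κ := ProbabilityTheory.condDistrib (id : Ω → Ω) r μ
  have hdis : ∀ F : T → Ω → ℝ≥0∞, Measurable (Function.uncurry F) →
      ∫⁻ x, F (r x) x ∂μ = ∫⁻ t, ∫⁻ x, F t x ∂(κ t) ∂(μ.map r) := by
    intro F hF
    have h := ProbabilityTheory.compProd_map_condDistrib (mβ := inferInstance) (μ := μ) (X := r)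
      (Y := (id : Ω → Ω)) aemeasurable_id
    have h1 := Measure.lintegral_compProd (μ := μ.map r) (κ := κ) hF
    rw [h, lintegral_map hF (by fun_prop)] at h1
    exact h1
  let u : T → S → ℝ≥0∞ := fun t y => ∫⁻ x, ENNReal.ofReal (p x y) ∂(κ t)
  have hum : Measurable (Function.uncurry u) := by
    have : Measurable (fun q : (T × S) × Ω => ENNReal.ofReal (p q.2 q.1.2)) := by
      apply Measurable.ennreal_ofReal
      exact hpm.comp (measurable_snd.prodMk (measurable_snd.comp measurable_fst))
    exact Measurable.lintegral_kernel_prod_right'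
      (κ := ProbabilityTheory.Kernel.comap κ (Prod.fst : T × S → T) measurable_fst) this
  have hpx : ∀ y, Measurable (fun x => p x y) := fun y =>
    hpm.comp (measurable_id.prodMk measurable_const)
  have hpy : ∀ x, Measurable (p x) := fun x =>
    hpm.comp (measurable_const.prodMk measurable_id)
  have hu0 : ∀ t y, u t y ≠ 0 := by
    intro t y h
    have h2 := (lintegral_eq_zero_iff (hpx y).ennreal_ofReal).1 h
    have h3 : ∀ᵐ x ∂(κ t), False := by
      filter_upwards [h2] with x hx
      simp at hx
      exact absurd (hp x y) (not_lt.2 hx)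
    simp at h3
    exact (IsProbabilityMeasure.ne_zero (κ t)) h3
  have hp1' : ∀ x, ∫⁻ y, ENNReal.ofReal (p x y) ∂ν = 1 := by
    intro x
    rw [← ofReal_integral_eq_lintegral_ofReal (integrable_of_one (hp1 x))
      (Filter.Eventually.of_forall fun y => (hp x y).le), hp1 x, ENNReal.ofReal_one]
  have hu1 : ∀ t, ∫⁻ y, u t y ∂ν = 1 := by
    intro t
    change ∫⁻ y, ∫⁻ x, ENNReal.ofReal (p x y) ∂(κ t) ∂ν = 1
    rw [lintegral_lintegral_swap]
    · simp_rw [hp1']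
      simp
    · exact (hpm.comp measurable_swap).ennreal_ofReal.aemeasurable
  have hut : ∀ t, Measurable (u t) := fun t =>
    hum.comp (measurable_const.prodMk measurable_id)
  have hutop : ∀ t, ∀ᵐ y ∂ν, u t y ≠ ⊤ := by
    intro t
    filter_upwards [ae_lt_top (hut t) (by rw [hu1]; simp)] with y hy using hy.ne
  classical
  let g : T → S → ℝ := fun t y => if u t y = ⊤ then 1 else (u t y).toReal
  have hgm : Measurable (Function.uncurry g) := by
    have : Function.uncurry g = fun q => if Function.uncurry u q = ⊤ then 1
      else (Function.uncurry u q).toReal := by ext ⟨t, y⟩; rfl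
    rw [this]
    exact Measurable.ite (hum (measurableSet_singleton ⊤)) measurable_const hum.ennreal_toReal
  have hgpos : ∀ t y, 0 < g t y := by
    intro t y
    simp only [g]
    split_ifs with h
    · exact one_pos
    · exact ENNReal.toReal_pos (hu0 t y) h
  have hgu : ∀ t, ∀ᵐ y ∂ν, ENNReal.ofReal (g t y) = u t y := by
    intro t
    filter_upwards [hutop t] with y hy
    simp only [g, if_neg hy, ENNReal.ofReal_toReal hy]
  refine ⟨g, hgm, hgpos, ?_, ?_, ?_⟩
  · intro t
    have hgt : Measurable (g t) := hgm.comp (measurable_const.prodMk measurable_id)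
    rw [integral_eq_lintegral_of_nonneg_ae (Filter.Eventually.of_forall fun y => (hgpos t y).le)
      hgt.aestronglyMeasurable, lintegral_congr_ae (hgu t), hu1]
    simp
  · intro A B hA hB
    have hA' : MeasurableSet {x | r x ∈ A} := hr hA
    rw [← lintegral_indicator hA', ← lintegral_indicator hA']
    have h1 := hdis (fun t x => A.indicator (fun _ => ∫⁻ y in B, ENNReal.ofReal (p x y) ∂ν) t) (by
      have hm : Measurable (fun x => ∫⁻ y in B, ENNReal.ofReal (p x y) ∂ν) :=
        Measurable.lintegral_prod_right' (f := fun q : Ω × S => ENNReal.ofReal (p q.1 q.2))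
          hpm.ennreal_ofReal
      exact (hm.comp measurable_snd).indicator (measurable_fst hA))
    have h2 := hdis (fun t x => A.indicator (fun t => ∫⁻ y in B, ENNReal.ofReal (g t y) ∂ν) t) (by
      have hm : Measurable (fun x => ∫⁻ y in B, ENNReal.ofReal (g x y) ∂ν) :=
        Measurable.lintegral_prod_right' (f := fun q : T × S => ENNReal.ofReal (g q.1 q.2))
          hgm.ennreal_ofReal
      exact (hm.indicator hA).comp measurable_fst)
    have e1 : ∀ x, ({x | r x ∈ A}.indicator
        (fun x => ∫⁻ y in B, ENNReal.ofReal (p x y) ∂ν) x) =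
        A.indicator (fun _ => ∫⁻ y in B, ENNReal.ofReal (p x y) ∂ν) (r x) := by
      intro x; by_cases hx : r x ∈ A <;> simp [hx]
    have e2 : ∀ x, ({x | r x ∈ A}.indicator
        (fun x => ∫⁻ y in B, ENNReal.ofReal (g (r x) y) ∂ν) x) =
        A.indicator (fun t => ∫⁻ y in B, ENNReal.ofReal (g t y) ∂ν) (r x) := by
      intro x; by_cases hx : r x ∈ A <;> simp [hx]
    simp_rw [e1, e2]
    rw [h1, h2]
    apply lintegral_congr
    intro t
    by_cases ht : t ∈ A
    · simp only [Set.indicator_of_mem ht]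
      rw [lintegral_lintegral_swap hpm.ennreal_ofReal.aemeasurable,
        lintegral_congr_ae (ae_restrict_of_ae (hgu t))]
      simp [u]
    · simp [ht]
  · intro f hfm hf
    have hM : ∀ f : T → S → ℝ, Measurable (Function.uncurry f) →
        Measurable (fun q : (T × Ω) × S => ENNReal.ofReal (kg (p q.1.2 q.2) (f q.1.1 q.2))) := by
      intro f hfm
      apply Measurable.ennreal_ofReal
      have m1 : Measurable (fun q : (T × Ω) × S => p q.1.2 q.2) :=
        hpm.comp ((measurable_snd.comp measurable_fst).prodMk measurable_snd)
      have m2 : Measurable (fun q : (T × Ω) × S => f q.1.1 q.2) :=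
        hfm.comp ((measurable_fst.comp measurable_fst).prodMk measurable_snd)
      exact kg_measurable.comp (m1.prodMk m2)
    have hD : ∀ f : T → S → ℝ, Measurable (Function.uncurry f) →
        ∫⁻ x, ∫⁻ y, ENNReal.ofReal (kg (p x y) (f (r x) y)) ∂ν ∂μ =
        ∫⁻ t, ∫⁻ y, ∫⁻ x, ENNReal.ofReal (kg (p x y) (f t y)) ∂(κ t) ∂ν ∂(μ.map r) := by
      intro f hfm
      rw [hdis (fun t x => ∫⁻ y, ENNReal.ofReal (kg (p x y) (f t y)) ∂ν)
        (Measurable.lintegral_prod_right' (hM f hfm))]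
      apply lintegral_congr
      intro t
      rw [lintegral_lintegral_swap]
      have m : Measurable (fun q : Ω × S => ((t, q.1), q.2)) := by fun_prop
      exact ((hM f hfm).comp m).aemeasurable
    rw [hD g hgm, hD f hfm]
    apply lintegral_mono
    intro t
    apply lintegral_mono_ae
    filter_upwards [hutop t] with y hy
    have hi : Integrable (fun x => p x y) (κ t) := by
      refine ⟨(hpx y).aestronglyMeasurable, ?_⟩
      rw [hasFiniteIntegral_iff_ofReal (Filter.Eventually.of_forall fun x => (hp x y).le)]
      exact lt_top_iff_ne_top.2 hy
    have hgi : g t y = ∫ x, p x y ∂(κ t) := by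
      rw [integral_eq_lintegral_of_nonneg_ae (Filter.Eventually.of_forall fun x => (hp x y).le)
        (hpx y).aestronglyMeasurable]
      simp only [g, if_neg hy]
      rfl
    have := compensation (κ t) (fun x => hp x y) (hpx y) hi (hgi ▸ hgpos t y) (hf t y)
    rw [hgi]
    exact this

lemma prod_upd {n : ℕ} {Y : Fin n → Type*} (a : ∀ j, Y j → ℝ) (j : Fin n) (c : Y j → ℝ)
    (y : ∀ j, Y j) :
    ∏ k, (Function.update a j (fun z => a j z * c z)) k (y k) = (∏ k, a k (y k)) * c (y j) := by
  have h : ∀ k, (Function.update a j (fun z => a j z * c z)) k (y k) =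
      Function.update (fun k => a k (y k)) j (a j (y j) * c (y j)) k := fun k =>
    Function.apply_update (fun k (f : Y k → ℝ) => f (y k)) a j _ k
  simp_rw [h]
  rw [Finset.prod_update_of_mem (Finset.mem_univ j),
    ← Finset.prod_sdiff (Finset.subset_univ {j}) (f := fun k => a k (y k)), Finset.prod_singleton]
  ring

lemma integral_upd {n : ℕ} {Y : Fin n → Type*} [∀ j, MeasurableSpace (Y j)]
    (ν : ∀ j, Measure (Y j)) [∀ j, SigmaFinite (ν j)]
    (a : ∀ j, Y j → ℝ) (ha1 : ∀ j, ∫ y, a j y ∂(ν j) = 1) (j : Fin n) (c : Y j → ℝ)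
    (hc : Integrable (fun z => a j z * c z) (ν j)) :
    Integrable (fun y : ∀ j, Y j => (∏ k, a k (y k)) * c (y j)) (Measure.pi ν) ∧
    ∫ y : ∀ j, Y j, (∏ k, a k (y k)) * c (y j) ∂(Measure.pi ν) = ∫ z, a j z * c z ∂(ν j) := by
  simp_rw [← prod_upd a j c]
  constructor
  · apply Integrable.fintype_prod_dep
    intro k
    by_cases hk : k = j
    · subst hk; simpa using hc
    · simpa [hk] using integrable_of_one (ha1 k)
  · rw [integral_fintype_prod_eq_prod, Finset.prod_eq_single j]
    · simp
    · intro k _ hk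
      simp [hk, ha1 k]
    · simp

lemma log_prod_eq {n : ℕ} {Y : Fin n → Type*} (a b : ∀ j, Y j → ℝ)
    (ha : ∀ j y, 0 < a j y) (hb : ∀ j y, 0 < b j y) (y : ∀ j, Y j) :
    Real.log ((∏ j, a j (y j)) / ∏ j, b j (y j)) = ∑ j, Real.log (a j (y j) / b j (y j)) := by
  rw [← Finset.prod_div_distrib, Real.log_prod]
  intro j _
  exact (div_pos (ha j _) (hb j _)).ne'

lemma integrable_of_prod {n : ℕ} {Y : Fin n → Type*} [∀ j, MeasurableSpace (Y j)]
    (ν : ∀ j, Measure (Y j)) [∀ j, SigmaFinite (ν j)]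
    (a b : ∀ j, Y j → ℝ) (ha : ∀ j y, 0 < a j y) (hb : ∀ j y, 0 < b j y)
    (ha1 : ∀ j, ∫ y, a j y ∂(ν j) = 1)
    (hi : Integrable (fun y : ∀ j, Y j => (∏ j, a j (y j)) *
      Real.log ((∏ j, a j (y j)) / ∏ j, b j (y j))) (Measure.pi ν)) (j : Fin n) :
    Integrable (fun z => a j z * Real.log (a j z / b j z)) (ν j) := by
  cases n with
  | zero => exact j.elim0
  | succ n =>
    have hmp := (measurePreserving_piFinSuccAbove ν j).symm
    rw [← hmp.integrable_comp_emb (MeasurableEquiv.measurableEmbedding _)] at hi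
    have h2 := hi.prod_left_ae
    have hR : ∫ w : ∀ k, Y (j.succAbove k), ∏ k, a (j.succAbove k) (w k)
        ∂(Measure.pi fun k => ν (j.succAbove k)) = 1 := by
      rw [integral_fintype_prod_eq_prod (fun k => a (j.succAbove k))]
      simp [ha1]
    have hne : (Measure.pi fun k => ν (j.succAbove k)) ≠ 0 := by
      intro h
      rw [h, integral_zero_measure] at hR
      exact zero_ne_one hR
    have : (ae (Measure.pi fun k => ν (j.succAbove k))).NeBot := ae_neBot.2 hne
    obtain ⟨w, hw⟩ := h2.exists
    have hRp : 0 < ∏ k, a (j.succAbove k) (w k) := Finset.prod_pos fun k _ => ha _ _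
    have hRp' : 0 < ∏ k, b (j.succAbove k) (w k) := Finset.prod_pos fun k _ => hb _ _
    set R := ∏ k, a (j.succAbove k) (w k) with hRdef
    set R' := ∏ k, b (j.succAbove k) (w k) with hRdef'
    have h3 : Integrable (fun z => (a j z * R) * Real.log ((a j z * R) / (b j z * R'))) (ν j) := by
      refine hw.congr (Filter.Eventually.of_forall fun z => ?_)
      simp [Fin.prod_univ_succAbove _ j, MeasurableEquiv.piFinSuccAbove_symm_apply,
        Fin.insertNthEquiv, hRdef, hRdef']
    have h4 := (h3.mul_const R⁻¹).sub ((integrable_of_one (ha1 j)).mul_const (Real.log (R / R')))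
    refine h4.congr (Filter.Eventually.of_forall fun z => ?_)
    simp only [Pi.sub_apply]
    rw [mul_div_mul_comm, Real.log_mul (div_pos (ha j z) (hb j z)).ne' (div_pos hRp hRp').ne']
    field_simp
    ring

open Classical in
lemma inner_prod_eq {n : ℕ} {Y : Fin n → Type*} [∀ j, MeasurableSpace (Y j)]
    (ν : ∀ j, Measure (Y j)) [∀ j, SigmaFinite (ν j)]
    (a b : ∀ j, Y j → ℝ) (ha : ∀ j y, 0 < a j y) (hb : ∀ j y, 0 < b j y)
    (ham : ∀ j, Measurable (a j)) (hbm : ∀ j, Measurable (b j))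
    (ha1 : ∀ j, ∫ y, a j y ∂(ν j) = 1) (hb1 : ∀ j, ∫ y, b j y ∂(ν j) = 1) :
    (if Integrable (fun y : ∀ j, Y j => (∏ j, a j (y j)) *
        Real.log ((∏ j, a j (y j)) / ∏ j, b j (y j))) (Measure.pi ν)
      then ENNReal.ofReal (∫ y : ∀ j, Y j, (∏ j, a j (y j)) *
        Real.log ((∏ j, a j (y j)) / ∏ j, b j (y j)) ∂(Measure.pi ν)) else ⊤) =
    ∑ j, ∫⁻ y, ENNReal.ofReal (kg (a j y) (b j y)) ∂(ν j) := by
  simp_rw [← fun j => inner_eq (ha j) (hb j) (ham j) (hbm j) (ha1 j) (hb1 j)]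
  by_cases hall : ∀ j, Integrable (fun z => a j z * Real.log (a j z / b j z)) (ν j)
  · have hU := fun j => integral_upd ν a ha1 j (fun z => Real.log (a j z / b j z)) (hall j)
    have hI : Integrable (fun y : ∀ j, Y j => (∏ j, a j (y j)) *
        Real.log ((∏ j, a j (y j)) / ∏ j, b j (y j))) (Measure.pi ν) := by
      simp_rw [log_prod_eq a b ha hb, Finset.mul_sum]
      exact integrable_finsetSum _ fun j _ => (hU j).1
    rw [if_pos hI]
    simp_rw [if_pos (hall _)]
    rw [← ENNReal.ofReal_sum_of_nonneg
      fun j _ => integral_log_nonneg (ha j) (hb j) (ha1 j) (hb1 j)]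
    congr 1
    simp_rw [log_prod_eq a b ha hb, Finset.mul_sum]
    rw [integral_finsetSum _ fun j _ => (hU j).1]
    exact Finset.sum_congr rfl fun j _ => (hU j).2
  · rw [if_neg fun hi => hall fun j => integrable_of_prod ν a b ha hb ha1 hi j]
    push Not at hall
    obtain ⟨j, hj⟩ := hall
    symm
    rw [ENNReal.sum_eq_top]
    exact ⟨j, Finset.mem_univ j, by rw [if_neg hj]⟩

lemma lintegral_coord {n : ℕ} {Y : Fin n → Type*} [∀ j, MeasurableSpace (Y j)]
    (ν : ∀ j, Measure (Y j)) [∀ j, SigmaFinite (ν j)]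
    (a : ∀ j, Y j → ℝ) (ha : ∀ j y, 0 < a j y)
    (ha1 : ∀ j, ∫ y, a j y ∂(ν j) = 1) (j : Fin n) (B : Set (Y j)) (hB : MeasurableSet B) :
    ∫⁻ y in {y : ∀ j', Y j' | y j ∈ B}, ENNReal.ofReal (∏ k, a k (y k)) ∂(Measure.pi ν) =
    ∫⁻ z in B, ENNReal.ofReal (a j z) ∂(ν j) := by
  have hB' : MeasurableSet {y : ∀ j', Y j' | y j ∈ B} := measurable_pi_apply j hB
  have hc : Integrable (fun z => a j z * B.indicator (fun _ => (1 : ℝ)) z) (ν j) := by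
    refine ((integrable_of_one (ha1 j)).indicator hB).congr
      (Filter.Eventually.of_forall fun z => ?_)
    by_cases hz : z ∈ B <;> simp [hz]
  obtain ⟨h1, h2⟩ := integral_upd ν a ha1 j (B.indicator fun _ => (1 : ℝ)) hc
  have hn : ∀ z, 0 ≤ B.indicator (fun _ => (1 : ℝ)) z := fun z =>
    Set.indicator_nonneg (fun _ _ => zero_le_one) z
  have e1 := ofReal_integral_eq_lintegral_ofReal h1 (Filter.Eventually.of_forall fun y =>
    mul_nonneg (Finset.prod_nonneg fun k _ => (ha k _).le) (hn _))
  have e2 := ofReal_integral_eq_lintegral_ofReal hc (Filter.Eventually.of_forall fun y =>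
    mul_nonneg (ha j _).le (hn _))
  rw [h2, e2] at e1
  rw [← lintegral_indicator hB', ← lintegral_indicator hB]
  convert e1.symm using 1
  · apply lintegral_congr
    intro y
    by_cases hz : y j ∈ B <;> simp [hz]
  · apply lintegral_congr
    intro z
    by_cases hz : z ∈ B <;> simp [hz]

/-- Factors of a positive product, each of total mass one, are positive. -/
lemma factors_pos {n : ℕ} {Y : Fin n → Type*} [∀ j, MeasurableSpace (Y j)]
    (ν : ∀ j, Measure (Y j)) (b : ∀ j, Y j → ℝ) (hY : ∀ j, Nonempty (Y j))
    (hb1 : ∀ j, ∫ y, b j y ∂(ν j) = 1)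
    (hpos : ∀ y : ∀ j, Y j, 0 < ∏ j, b j (y j)) (j : Fin n) (z : Y j) : 0 < b j z := by
  by_contra hz
  have hne : b j z ≠ 0 := by
    intro h0
    have y0 : ∀ k, Y k := fun k => (hY k).some
    have := hpos (Function.update y0 j z)
    rw [Finset.prod_eq_zero (Finset.mem_univ j) (by simpa using h0)] at this
    exact lt_irrefl _ this
  have hz' : b j z < 0 := lt_of_le_of_ne (not_lt.1 hz) hne
  have y0 : ∀ k, Y k := fun k => (hY k).some
  have hform : ∀ w : Y j, ∏ k, b k (Function.update y0 j w k) =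
      b j w * ∏ k ∈ Finset.univ \ {j}, b k (y0 k) := by
    intro w
    have h : ∀ k, b k (Function.update y0 j w k) =
        Function.update (fun k => b k (y0 k)) j (b j w) k := fun k =>
      Function.apply_update (fun k (v : Y k) => b k v) y0 j w k
    simp_rw [h]
    rw [Finset.prod_update_of_mem (Finset.mem_univ j)]
  have hall : ∀ w, b j w ≤ 0 := by
    intro w
    by_contra hw
    push Not at hw
    have h1 := hpos (Function.update y0 j z)
    have h2 := hpos (Function.update y0 j w)
    rw [hform] at h1 h2
    have h3 := (pos_iff_pos_of_mul_pos h2).1 hw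
    nlinarith
  have := integral_nonpos (μ := ν j) (f := b j) hall
  rw [hb1 j] at this
  linarith

lemma restr_measurable {N M : ℕ} {X : Fin (N + M) → Type*} [∀ i, MeasurableSpace (X i)]
    (T : Finset (Fin (N + M))) : Measurable (restr (X := X) T) :=
  measurable_pi_lambda _ fun i => measurable_pi_apply i.val

lemma condMeasure_prob {N M : ℕ} {X : Fin (N + M) → Type*} [∀ i, MeasurableSpace (X i)]
    (μ : Measure (∀ i, X i)) [IsProbabilityMeasure μ] (E : Set (∀ i, X i)) (hEpos : 0 < μ E) :
    IsProbabilityMeasure (condMeasure μ E) := by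
  constructor
  simp only [condMeasure, Measure.smul_apply, Measure.restrict_apply_univ, smul_eq_mul]
  exact ENNReal.inv_mul_cancel hEpos.ne' (measure_ne_top _ _)

lemma condMeasure_ae_mem {N M : ℕ} {X : Fin (N + M) → Type*} [∀ i, MeasurableSpace (X i)]
    (μ : Measure (∀ i, X i)) (E : Set (∀ i, X i)) (hE : MeasurableSet E) :
    ∀ᵐ x ∂(condMeasure μ E), x ∈ E :=
  Measure.ae_smul_measure (ae_restrict_mem hE) _

/-- `klE` as a sum of coordinatewise relative entropies. -/
lemma klE_eq {N M : ℕ} {X : Fin (N + M) → Type*} {Y : Fin N → Type*}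
    [∀ i, MeasurableSpace (X i)] [∀ j, MeasurableSpace (Y j)]
    (μ : Measure (∀ i, X i)) (ν : ∀ j, Measure (Y j)) [∀ j, SigmaFinite (ν j)]
    (pj : ∀ j, (∀ i, X i) → Y j → ℝ) (hp : IsFTD ν pj)
    (E : Set (∀ i, X i)) (hE : MeasurableSet E)
    (G : Fin N → Finset (Fin (N + M)))
    (f : (∀ i, X i) → (∀ j, Y j) → ℝ)
    (fj : ∀ j : Fin N, ((i : {i // i ∈ G j}) → X i.val) → Y j → ℝ)
    (hm : ∀ j, Measurable (Function.uncurry (fj j)))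
    (hpos : ∀ j t y, 0 < fj j t y)
    (h1 : ∀ j, ∀ x ∈ E, ∫ y, fj j (restr (G j) x) y ∂(ν j) = 1)
    (hf : ∀ x ∈ E, ∀ y : ∀ j, Y j, f x y = ∏ j, fj j (restr (G j) x) (y j)) :
    klE μ ν (Pfull pj) f E =
      ∑ j, ∫⁻ x, ∫⁻ y, ENNReal.ofReal (kg (pj j x y) (fj j (restr (G j) x) y)) ∂(ν j)
        ∂(condMeasure μ E) := by
  classical
  rw [← lintegral_finsetSum]
  · unfold klE
    apply lintegral_congr_ae
    filter_upwards [condMeasure_ae_mem μ E hE] with x hx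
    rw [← inner_prod_eq ν (fun j => pj j x) (fun j => fj j (restr (G j) x))
      (fun j y => hp.pos j x y) (fun j y => hpos j _ y)
      (fun j => (hp.measurable j).comp (measurable_const.prodMk measurable_id))
      (fun j => (hm j).comp (measurable_const.prodMk measurable_id))
      (fun j => hp.density j x) (fun j => h1 j x hx)]
    have hfx : f x = fun y : ∀ j, Y j => ∏ j, fj j (restr (G j) x) (y j) := funext (hf x hx)
    rw [hfx]
    unfold Pfull
    congr
  · intro j _
    refine Measurable.lintegral_prod_right' (f := fun q : (∀ i, X i) × Y j =>
      ENNReal.ofReal (kg (pj j q.1 q.2) (fj j (restr (G j) q.1) q.2))) ?_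
    apply Measurable.ennreal_ofReal
    have m2 : Measurable (fun q : (∀ i, X i) × Y j => fj j (restr (G j) q.1) q.2) :=
      (hm j).comp (((restr_measurable (G j)).comp measurable_fst).prodMk measurable_snd)
    exact kg_measurable.comp ((hp.measurable j).prodMk m2)

/-- the product of conditional marginal densities is the KL-projection of
`p` onto the factorized class `F_E(G)`: there exists `f̂ ∈ F_E(G)`, built from versions
`f̂_j` of the conditional density of `Y j` given `x_{Pa^G(j)}` under the joint law
`μ_E(dx) p(x,y) ν(dy)`, which minimizes `KL_E(p, ·)` over `F_E(G)`. -/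
theorem kl_projection_exists
    (hN : 0 < N) (hM : 0 < M)
    [∀ i, StandardBorelSpace (X i)] [∀ j, StandardBorelSpace (Y j)]
    (μ : Measure (∀ i, X i)) [IsProbabilityMeasure μ]
    (ν : ∀ j, Measure (Y j)) [∀ j, SigmaFinite (ν j)]
    (pj : ∀ j, (∀ i, X i) → Y j → ℝ) (hp : IsFTD ν pj)
    (E : Set (∀ i, X i)) (hE : MeasurableSet E) (hEpos : 0 < μ E)
    (G : Fin N → Finset (Fin (N + M))) :
    ∃ fj : ∀ j : Fin N, ((i : {i // i ∈ G j}) → X i.val) → Y j → ℝ,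
      (∀ j, Measurable (Function.uncurry (fj j))) ∧
      -- each `fj j` is a version of the conditional density of the coordinate `Y j`
      -- given `x_{Pa^G(j)}` under the joint law `μ_E(dx) p(x,y) ν(dy)`:
      (∀ j : Fin N, ∀ A : Set ((i : {i // i ∈ G j}) → X i.val), ∀ B : Set (Y j),
        MeasurableSet A → MeasurableSet B →
        ∫⁻ x in {x | restr (G j) x ∈ A},
            (∫⁻ y in {y : ∀ j', Y j' | y j ∈ B},
              ENNReal.ofReal (Pfull pj x y) ∂(Measure.pi ν)) ∂(condMeasure μ E)
          = ∫⁻ x in {x | restr (G j) x ∈ A},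
              (∫⁻ yj in B, ENNReal.ofReal (fj j (restr (G j) x) yj) ∂(ν j))
            ∂(condMeasure μ E)) ∧
      MemF ν E G (fun x y => ∏ j, fj j (restr (G j) x) (y j)) ∧
      (∀ f, MemF ν E G f →
        klE μ ν (Pfull pj) (fun x y => ∏ j, fj j (restr (G j) x) (y j)) E ≤
          klE μ ν (Pfull pj) f E) ∧
      (⨅ f ∈ {f | MemF ν E G f}, klE μ ν (Pfull pj) f E) =
        klE μ ν (Pfull pj) (fun x y => ∏ j, fj j (restr (G j) x) (y j)) E := by
  classical
  have hprob := condMeasure_prob μ E hEpos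
  choose fj hm hpos h1 hcond hmin using fun j =>
    exists_proj (condMeasure μ E) (ν j) (restr (G j)) (restr_measurable (G j)) (pj j)
      (hp.measurable j) (hp.pos j) (hp.density j)
  have hmem : MemF ν E G (fun x y => ∏ j, fj j (restr (G j) x) (y j)) := by
    refine ⟨?_, fun x y => Finset.prod_pos fun j _ => hpos j _ _, fun x => ?_, fj, hm,
      fun j x _ => h1 j _, fun x _ y => rfl⟩
    · refine Finset.measurable_prod (f := fun j (q : (∀ i, X i) × (∀ j, Y j)) =>
        fj j (restr (G j) q.1) (q.2 j)) _ fun j _ => ?_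
      exact (hm j).comp (((restr_measurable (G j)).comp measurable_fst).prodMk
        ((measurable_pi_apply j).comp measurable_snd))
    · rw [integral_fintype_prod_eq_prod (fun j => fj j (restr (G j) x))]
      simp [h1]
  have hle : ∀ f, MemF ν E G f →
        klE μ ν (Pfull pj) (fun x y => ∏ j, fj j (restr (G j) x) (y j)) E ≤
          klE μ ν (Pfull pj) f E := by
    rintro f ⟨-, fpos, -, gj, gm, g1, gf⟩
    let gj' : ∀ j : Fin N, ((i : {i // i ∈ G j}) → X i.val) → Y j → ℝ :=
      fun j t y => if 0 < gj j t y then gj j t y else 1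
    have gm' : ∀ j, Measurable (Function.uncurry (gj' j)) := fun j =>
      Measurable.ite (measurableSet_lt measurable_const (gm j)) (gm j) measurable_const
    have gpos' : ∀ j t y, 0 < gj' j t y := by
      intro j t y
      simp only [gj']
      split_ifs with h
      · exact h
      · exact one_pos
    have heq : ∀ j, ∀ x ∈ E, ∀ y, gj' j (restr (G j) x) y = gj j (restr (G j) x) y := by
      intro j x hx y
      have hY : ∀ j, Nonempty (Y j) := by
        intro j
        by_contra h
        rw [not_nonempty_iff] at h
        have := hp.density j x
        rw [integral_of_isEmpty] at this
        exact zero_ne_one this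
      exact if_pos (factors_pos ν (fun j => gj j (restr (G j) x)) hY (fun j => g1 j x hx)
        (fun y => (gf x hx y) ▸ fpos x y) j y)
    rw [klE_eq μ ν pj hp E hE G _ fj hm hpos (fun j x _ => h1 j _) (fun x _ y => rfl),
      klE_eq μ ν pj hp E hE G f gj' gm' gpos'
        (fun j x hx => by simp_rw [heq j x hx]; exact g1 j x hx)
        (fun x hx y => by simp_rw [fun j => heq j x hx]; exact gf x hx y)]
    exact Finset.sum_le_sum fun j _ => hmin j (gj' j) (gm' j) (gpos' j)
  refine ⟨fj, hm, ?_, hmem, hle, ?_⟩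
  · intro j A B hA hB
    rw [← hcond j A B hA hB]
    apply lintegral_congr
    intro x
    exact lintegral_coord ν (fun j => pj j x) (fun j y => hp.pos j x y)
      (fun j => hp.density j x) j B hB
  · apply le_antisymm
    · exact iInf₂_le _ hmem
    · exact le_iInf₂ hle


end FCDL
end
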